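/- Let A be a primitive set with f(A) > ∑_{p ∈ 𝒫(A)} 1/(p·log p) + ε₀. Then f(A₃) < ∑_{p ∈ 𝒫(A₃)} 1/(p·log p), where A₃ denotes the set of odd elements of A. -/

import Mathlib

open scoped BigOperators

/-- A set of positive integers is *primitive* if every element exceeds 1 and
no element divides another element. -/
def IsPrimitive (A : Set ℕ) : Prop :=
  (∀ a ∈ A, 1 < a) ∧ ∀ a ∈ A, ∀ b ∈ A, a ≠ b → ¬ a ∣ b

/-- `f A = ∑_{a ∈ A} 1/(a log a)`. -/
noncomputable def f (A : Set ℕ) : ℝ :=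
  ∑' a : A, 1 / ((a : ℕ) * Real.log (a : ℕ))

/-- The support `𝒫(A)` of a set `A`: the primes dividing some member of `A`. -/
def primeSupport (A : Set ℕ) : Set ℕ :=
  {p : ℕ | p.Prime ∧ ∃ a ∈ A, p ∣ a}

/-- `g p = (1/p) ∏_{r prime, r < p} (1 - 1/r)`. -/
noncomputable def g (p : ℕ) : ℝ :=
  (1 / p) * ∏ r ∈ p.primesBelow, (1 - 1 / (r : ℝ))

/-- A prime `q` is *Mertens* if `e^γ ∏_{r < q} (1 - 1/r) ≤ 1/log q`. -/
def IsMertens (q : ℕ) : Prop :=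
  Real.exp Real.eulerMascheroniConstant * ∏ r ∈ q.primesBelow, (1 - 1 / (r : ℝ)) ≤
    1 / Real.log q

/-- `ε₀ = ∑_{p odd prime, p not Mertens} (e^γ g(p) - 1/(p log p))`. -/
noncomputable def eps0 : ℝ :=
  ∑' p : {p : ℕ // p.Prime ∧ 2 < p ∧ ¬ IsMertens p},
    (Real.exp Real.eulerMascheroniConstant * g p -
      1 / ((p : ℕ) * Real.log (p : ℕ)))

theorem one_sub_half_le_exp_neg_mul {x : ℝ} (hx : 0 ≤ x) :
    1 - x / 2 ≤ Real.exp (-x) * (1 + x / 2) := by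
  have hd : ∀ y : ℝ, HasDerivAt (fun y : ℝ => Real.exp (-y) * (1 + y / 2) + y / 2)
      (Real.exp (-y) * -1 * (1 + y / 2) + Real.exp (-y) * (1 / 2) + 1 / 2) y := by
    intro y
    have h1 : HasDerivAt (fun y : ℝ => Real.exp (-y)) (Real.exp (-y) * -1) y :=
      (hasDerivAt_neg y).exp
    have h2 : HasDerivAt (fun y : ℝ => y / 2) (1 / 2) y := (hasDerivAt_id y).div_const 2
    exact (h1.mul (h2.const_add 1)).add h2
  have hm : Monotone (fun y : ℝ => Real.exp (-y) * (1 + y / 2) + y / 2) := by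
    refine monotone_of_hasDerivAt_nonneg hd fun y => ?_
    have h1 := Real.add_one_le_exp y
    have h2 : Real.exp (-y) * Real.exp y = 1 := by rw [← Real.exp_add]; simp
    have h3 := Real.exp_pos (-y)
    simp only [Pi.zero_apply]
    nlinarith [mul_le_mul_of_nonneg_left h1 h3.le]
  have := hm hx
  simp at this
  linarith

theorem mul_exp_midpoint_le_exp_sub_exp {a b : ℝ} (h : b ≤ a) :
    (a - b) * Real.exp ((a + b) / 2) ≤ Real.exp a - Real.exp b := by
  have h1 := Real.self_le_sinh_iff.2 (show 0 ≤ (a - b) / 2 by linarith)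
  rw [Real.sinh_eq] at h1
  have ha : Real.exp a = Real.exp ((a + b) / 2) * Real.exp ((a - b) / 2) := by
    rw [← Real.exp_add]; congr 1; ring
  have hb : Real.exp b = Real.exp ((a + b) / 2) * Real.exp (-((a - b) / 2)) := by
    rw [← Real.exp_add]; congr 1; ring
  rw [ha, hb]
  nlinarith [Real.exp_pos ((a + b) / 2)]

theorem exp_sub_exp_le_mul_average {a b : ℝ} (h : b ≤ a) :
    Real.exp a - Real.exp b ≤ (a - b) * ((Real.exp a + Real.exp b) / 2) := by
  have h1 := one_sub_half_le_exp_neg_mul (show 0 ≤ a - b by linarith)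
  have hb : Real.exp b = Real.exp a * Real.exp (-(a - b)) := by
    rw [← Real.exp_add]; congr 1; ring
  rw [hb]
  nlinarith [Real.exp_pos a]

theorem rpow_neg_eq_exp {x : ℝ} (hx : 0 < x) (s : ℝ) :
    x ^ (-s) = Real.exp (-s * Real.log x) := by
  rw [Real.rpow_def_of_pos hx, mul_comm]

theorem mul_rpow_le_sub_midpoint {s x : ℝ} (hs : 0 < s) (hx : 1 ≤ x) :
    s * x ^ (-(1 + s)) ≤ (x - 1 / 2) ^ (-s) - (x + 1 / 2) ^ (-s) := by
  have h0 : 0 < x - 1 / 2 := by linarith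
  have h1 : 0 < x + 1 / 2 := by linarith
  have hx0 : 0 < x := by linarith
  have hlog : 1 / x ≤ Real.log (x + 1 / 2) - Real.log (x - 1 / 2) := by
    obtain ⟨y, rfl⟩ : ∃ y, x = y + 1 / 2 := ⟨x - 1 / 2, by ring⟩
    rw [add_sub_cancel_right] at h0 ⊢
    have := Real.le_log_one_add_of_nonneg (show 0 ≤ 1 / y by positivity)
    rw [← Real.log_div h1.ne' h0.ne']
    convert this using 1
    · field_simp; ring
    · congr 1; field_simp; ring
  have hle : Real.log (x - 1 / 2) ≤ Real.log (x + 1 / 2) := Real.log_le_log h0 (by linarith)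
  have hsum : Real.log (x - 1 / 2) + Real.log (x + 1 / 2) ≤ 2 * Real.log x := by
    rw [← Real.log_mul h0.ne' h1.ne', ← Real.log_rpow hx0]
    refine Real.log_le_log (by positivity) ?_
    norm_num; nlinarith
  rw [rpow_neg_eq_exp h0, rpow_neg_eq_exp h1]
  refine le_trans ?_ (mul_exp_midpoint_le_exp_sub_exp (by nlinarith))
  have : x ^ (-(1 + s)) = 1 / x * Real.exp (-s * Real.log x) := by
    rw [← rpow_neg_eq_exp hx0, show -(1 + s) = -1 + -s by ring, Real.rpow_add hx0,
      Real.rpow_neg_one, one_div]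
  rw [this, ← mul_assoc]
  refine mul_le_mul ?_ (Real.exp_le_exp.2 (by nlinarith)) (Real.exp_pos _).le (by nlinarith)
  nlinarith

theorem log_sub_log_mul_rpow_midpoint_le {s x : ℝ} (hs : 0 < s) (hx : 1 ≤ x) :
    s * ((Real.log (x + 1) - Real.log x) * (x + 1 / 2) ^ (-s)) ≤ x ^ (-s) - (x + 1) ^ (-s) := by
  have hx0 : 0 < x := by linarith
  have h1 : 0 < x + 1 := by linarith
  have h2 : 0 < x + 1 / 2 := by linarith
  have hle : Real.log x ≤ Real.log (x + 1) := Real.log_le_log hx0 (by linarith)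
  have hsum : Real.log x + Real.log (x + 1) ≤ 2 * Real.log (x + 1 / 2) := by
    rw [← Real.log_mul hx0.ne' h1.ne', ← Real.log_rpow h2]
    refine Real.log_le_log (by positivity) ?_
    norm_num; nlinarith
  rw [rpow_neg_eq_exp hx0, rpow_neg_eq_exp h1, rpow_neg_eq_exp h2]
  refine le_trans ?_ (mul_exp_midpoint_le_exp_sub_exp (by nlinarith))
  rw [← mul_assoc]
  refine mul_le_mul (by linarith) (Real.exp_le_exp.2 (by nlinarith)) (Real.exp_pos _).le
    (by nlinarith)

theorem rpow_sub_rpow_le_trapezoid {s x : ℝ} (hs : 0 < s) (hx : 1 ≤ x) :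
    x ^ (-s) - (x + 1) ^ (-s) ≤ s * ((x ^ (-(1 + s)) + (x + 1) ^ (-(1 + s))) / 2) := by
  have hx0 : 0 < x := by linarith
  have h1 : 0 < x + 1 := by linarith
  have hle : Real.log x ≤ Real.log (x + 1) := Real.log_le_log hx0 (by linarith)
  have hlog : Real.log (x + 1) - Real.log x ≤ (1 / x + 1 / (x + 1)) / 2 := by
    rw [← Real.log_div h1.ne' hx0.ne']
    have h3 : 0 ≤ Real.log ((x + 1) / x) :=
      Real.log_nonneg (by rw [le_div_iff₀ hx0]; linarith)
    refine (Real.self_le_sinh_iff.2 h3).trans (le_of_eq ?_)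
    rw [Real.sinh_log (by positivity)]
    field_simp; ring
  have hpow : ∀ y : ℝ, 0 < y → y ^ (-(1 + s)) = 1 / y * y ^ (-s) := fun y hy => by
    rw [show -(1 + s) = -1 + -s by ring, Real.rpow_add hy, Real.rpow_neg_one, one_div]
  have hanti : (x + 1) ^ (-s) ≤ x ^ (-s) :=
    Real.rpow_le_rpow_of_nonpos hx0 (by linarith) (by linarith)
  have hinv : 1 / (x + 1) ≤ 1 / x := one_div_le_one_div_of_le hx0 (by linarith)
  have hmain : x ^ (-s) - (x + 1) ^ (-s)
      ≤ s * (Real.log (x + 1) - Real.log x) * ((x ^ (-s) + (x + 1) ^ (-s)) / 2) := by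
    rw [rpow_neg_eq_exp hx0, rpow_neg_eq_exp h1]
    refine (exp_sub_exp_le_mul_average (by nlinarith)).trans (le_of_eq ?_)
    ring
  have hp1 : 0 < x ^ (-s) := Real.rpow_pos_of_pos hx0 _
  have hp2 : 0 < (x + 1) ^ (-s) := Real.rpow_pos_of_pos h1 _
  rw [hpow x hx0, hpow _ h1]
  refine hmain.trans ?_
  rw [mul_assoc]
  refine mul_le_mul_of_nonneg_left ?_ hs.le
  refine (mul_le_mul_of_nonneg_right hlog (by positivity)).trans ?_
  nlinarith [mul_nonneg (sub_nonneg.2 hanti) (sub_nonneg.2 hinv)]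

theorem sum_log_mul_rpow_le {s : ℝ} (hs : 0 < s) (K : ℕ) :
    ∑ n ∈ Finset.Icc 1 K, Real.log n * (n : ℝ) ^ (-(1 + s)) ≤ 1 / s ^ 2 := by
  have key : ∀ K : ℕ, s ^ 2 * ∑ n ∈ Finset.Icc 1 (K + 1), Real.log n * (n : ℝ) ^ (-(1 + s))
      + s * (Real.log ((K : ℝ) + 1) * ((K : ℝ) + 1 + 1 / 2) ^ (-s))
      ≤ 1 - ((K : ℝ) + 1) ^ (-s) := by
    intro K
    induction K with
    | zero => simp
    | succ K ih =>
      rw [Finset.sum_Icc_succ_top (by omega)]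
      push_cast
      have hK : (0 : ℝ) ≤ K := K.cast_nonneg
      have h1 := mul_rpow_le_sub_midpoint hs (show (1 : ℝ) ≤ (K : ℝ) + 1 + 1 by linarith)
      have h2 := log_sub_log_mul_rpow_midpoint_le hs (show (1 : ℝ) ≤ (K : ℝ) + 1 by linarith)
      rw [show (K : ℝ) + 1 + 1 - 1 / 2 = K + 1 + 1 / 2 by ring] at h1
      have hl : 0 ≤ Real.log ((K : ℝ) + 1 + 1) := Real.log_nonneg (by linarith)
      have h3 := mul_le_mul_of_nonneg_left h1 (mul_nonneg hs.le hl)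
      nlinarith
  have hmono : ∑ n ∈ Finset.Icc 1 K, Real.log n * (n : ℝ) ^ (-(1 + s))
      ≤ ∑ n ∈ Finset.Icc 1 (K + 1), Real.log n * (n : ℝ) ^ (-(1 + s)) := by
    refine Finset.sum_le_sum_of_subset_of_nonneg
      (Finset.Icc_subset_Icc_right (Nat.le_succ K)) fun n _ _ => ?_
    exact mul_nonneg (Real.log_natCast_nonneg n) (Real.rpow_nonneg n.cast_nonneg _)
  refine hmono.trans ?_
  rw [le_div_iff₀ (by positivity)]
  have hK : (0 : ℝ) ≤ K := K.cast_nonneg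
  have hl : 0 ≤ Real.log ((K : ℝ) + 1) := Real.log_nonneg (by linarith)
  have h1 : 0 ≤ s * (Real.log ((K : ℝ) + 1) * ((K : ℝ) + 1 + 1 / 2) ^ (-s)) := by positivity
  have h2 : 0 ≤ ((K : ℝ) + 1) ^ (-s) := by positivity
  linarith [key K]

theorem le_sum_rpow {s : ℝ} (hs : 0 < s) (M : ℕ) :
    1 / s + 1 / 2 - ((M : ℝ) + 1) ^ (-s) / s
      ≤ ∑ n ∈ Finset.Icc 1 (M + 1), (n : ℝ) ^ (-(1 + s)) := by
  have key : ∀ M : ℕ, 1 + s / 2 - ((M : ℝ) + 1) ^ (-s) + s * (((M : ℝ) + 1) ^ (-(1 + s)) / 2)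
      ≤ s * ∑ n ∈ Finset.Icc 1 (M + 1), (n : ℝ) ^ (-(1 + s)) := by
    intro M
    induction M with
    | zero => simp; linarith
    | succ M ih =>
      rw [Finset.sum_Icc_succ_top (by omega)]
      push_cast
      have hM : (0 : ℝ) ≤ M := M.cast_nonneg
      have := rpow_sub_rpow_le_trapezoid hs (show (1 : ℝ) ≤ (M : ℝ) + 1 by linarith)
      linarith
  have h := key M
  have h1 : 0 ≤ s * (((M : ℝ) + 1) ^ (-(1 + s)) / 2) := by positivity
  have h2 : 1 / s + 1 / 2 - ((M : ℝ) + 1) ^ (-s) / s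
      = (1 + s / 2 - ((M : ℝ) + 1) ^ (-s)) / s := by field_simp
  rw [h2, div_le_iff₀ hs]
  linarith

open ArithmeticFunction in
theorem sum_vonMangoldt_mul_rpow_le {s : ℝ} (hs : 0 < s) (X : ℕ) :
    ∑ q ∈ Finset.Icc 1 X, vonMangoldt q * (q : ℝ) ^ (-(1 + s)) ≤ 1 / s * (1 / (1 + s / 2)) := by
  set V := ∑ q ∈ Finset.Icc 1 X, vonMangoldt q * (q : ℝ) ^ (-(1 + s)) with hV
  have hV0 : 0 ≤ V := Finset.sum_nonneg fun q _ =>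
    mul_nonneg vonMangoldt_nonneg (Real.rpow_nonneg q.cast_nonneg _)
  have hprod : ∀ M : ℕ, V * ∑ m ∈ Finset.Icc 1 M, (m : ℝ) ^ (-(1 + s)) ≤ 1 / s ^ 2 := by
    intro M
    calc V * ∑ m ∈ Finset.Icc 1 M, (m : ℝ) ^ (-(1 + s))
        = ∑ q ∈ Finset.Icc 1 X, ∑ m ∈ Finset.Icc 1 M,
            vonMangoldt q * ((q * m : ℕ) : ℝ) ^ (-(1 + s)) := by
          rw [hV, Finset.sum_mul_sum]
          refine Finset.sum_congr rfl fun q _ => Finset.sum_congr rfl fun m _ => ?_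
          rw [Nat.cast_mul, Real.mul_rpow q.cast_nonneg m.cast_nonneg]
          ring
      _ ≤ ∑ q ∈ Finset.Icc 1 X, ∑ n ∈ Finset.Icc 1 (X * M),
            if q ∣ n then vonMangoldt q * (n : ℝ) ^ (-(1 + s)) else 0 := by
          refine Finset.sum_le_sum fun q hq => ?_
          rw [Finset.mem_Icc] at hq
          rw [← Finset.sum_filter, ← Finset.sum_image (s := Finset.Icc 1 M) (g := fun m => q * m)
            (f := fun n : ℕ => vonMangoldt q * (n : ℝ) ^ (-(1 + s)))
            (fun _ _ _ _ h => Nat.eq_of_mul_eq_mul_left hq.1 h)]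
          refine Finset.sum_le_sum_of_subset_of_nonneg (fun n hn => ?_) fun n _ _ =>
            mul_nonneg vonMangoldt_nonneg (Real.rpow_nonneg n.cast_nonneg _)
          obtain ⟨m, hm, rfl⟩ := Finset.mem_image.1 hn
          rw [Finset.mem_Icc] at hm
          exact Finset.mem_filter.2 ⟨Finset.mem_Icc.2 ⟨Nat.mul_pos hq.1 hm.1,
            Nat.mul_le_mul hq.2 hm.2⟩, dvd_mul_right q m⟩
      _ = ∑ n ∈ Finset.Icc 1 (X * M), ∑ q ∈ Finset.Icc 1 X,
            if q ∣ n then vonMangoldt q * (n : ℝ) ^ (-(1 + s)) else 0 := Finset.sum_comm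
      _ ≤ ∑ n ∈ Finset.Icc 1 (X * M), Real.log n * (n : ℝ) ^ (-(1 + s)) := by
          refine Finset.sum_le_sum fun n hn => ?_
          have hn0 : n ≠ 0 := Nat.one_le_iff_ne_zero.1 (Finset.mem_Icc.1 hn).1
          rw [← vonMangoldt_sum, Finset.sum_mul, ← Finset.sum_filter]
          refine Finset.sum_le_sum_of_subset_of_nonneg (fun q hq => ?_) fun q _ _ =>
            mul_nonneg vonMangoldt_nonneg (Real.rpow_nonneg n.cast_nonneg _)
          exact Nat.mem_divisors.2 ⟨(Finset.mem_filter.1 hq).2, hn0⟩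
      _ ≤ 1 / s ^ 2 := sum_log_mul_rpow_le hs _
  have hlim : Filter.Tendsto (fun M : ℕ => V * (1 / s + 1 / 2 - ((M : ℝ) + 1) ^ (-s) / s))
      Filter.atTop (nhds (V * (1 / s + 1 / 2 - 0 / s))) := by
    have h1 : Filter.Tendsto (fun M : ℕ => ((M : ℝ) + 1) ^ (-s)) Filter.atTop (nhds 0) :=
      (tendsto_rpow_neg_atTop hs).comp
        (Filter.tendsto_atTop_add_const_right _ _ tendsto_natCast_atTop_atTop)
    exact ((h1.div_const s).const_sub _).const_mul V
  have hle : V * (1 / s + 1 / 2 - 0 / s) ≤ 1 / s ^ 2 :=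
    le_of_tendsto' hlim fun M =>
      (mul_le_mul_of_nonneg_left (le_sum_rpow hs M) hV0).trans (hprod (M + 1))
  have h2 : 1 / s * (1 / (1 + s / 2)) = 1 / s ^ 2 / (1 / s + 1 / 2) := by
    field_simp
  rw [h2, le_div_iff₀ (by positivity)]
  simpa using hle

theorem integral_mul_exp_neg_mul {a : ℝ} (ha : 0 < a) :
    ∫ s in Set.Ioi (0 : ℝ), s * Real.exp (-(a * s)) = 1 / a ^ 2 := by
  have := Real.integral_rpow_mul_exp_neg_mul_Ioi (show (0 : ℝ) < 2 by norm_num) ha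
  norm_num at this
  simpa using this

theorem integrableOn_mul_exp_neg_mul {a : ℝ} (ha : 0 < a) :
    MeasureTheory.IntegrableOn (fun s : ℝ => s * Real.exp (-(a * s))) (Set.Ioi 0) := by
  have := integrableOn_rpow_mul_exp_neg_mul_rpow (show (-1 : ℝ) < 1 by norm_num) zero_lt_one ha
  simpa using this

open ArithmeticFunction in
theorem sum_vonMangoldt_div_mul_log_sq_le {L : ℝ} (hL : 0 < L) (X : ℕ) :
    ∑ q ∈ Finset.Icc 1 X, vonMangoldt q / (q * (Real.log q + L) ^ 2)
      ≤ 1 / 2 * (1 / L) + 1 / 2 * (1 / (L + 1)) := by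
  have hpos : ∀ q ∈ Finset.Icc 1 X, 0 < Real.log q + L := fun q _ =>
    add_pos_of_nonneg_of_pos (Real.log_natCast_nonneg q) hL
  have hint : ∀ q ∈ Finset.Icc 1 X, MeasureTheory.IntegrableOn
      (fun s : ℝ => vonMangoldt q / q * (s * Real.exp (-((Real.log q + L) * s)))) (Set.Ioi 0) :=
    fun q hq => (integrableOn_mul_exp_neg_mul (hpos q hq)).const_mul _
  have hL1 : 0 < L + 1 := by linarith
  have hexp : ∀ a : ℝ, 0 < a → MeasureTheory.IntegrableOn
      (fun s : ℝ => 1 / 2 * Real.exp (-a * s)) (Set.Ioi 0) := fun a ha =>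
    (integrableOn_exp_mul_Ioi (neg_lt_zero.2 ha) 0).const_mul _
  have hval : ∀ a : ℝ, 0 < a → ∫ s in Set.Ioi (0 : ℝ), 1 / 2 * Real.exp (-a * s)
      = 1 / 2 * (1 / a) := fun a ha => by
    rw [MeasureTheory.integral_const_mul, integral_exp_mul_Ioi (neg_lt_zero.2 ha)]
    simp [neg_div_neg_eq]
  calc ∑ q ∈ Finset.Icc 1 X, vonMangoldt q / (q * (Real.log q + L) ^ 2)
      = ∑ q ∈ Finset.Icc 1 X, ∫ s in Set.Ioi (0 : ℝ),
          vonMangoldt q / q * (s * Real.exp (-((Real.log q + L) * s))) := by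
        refine Finset.sum_congr rfl fun q hq => ?_
        rw [MeasureTheory.integral_const_mul, integral_mul_exp_neg_mul (hpos q hq), div_mul_div_comm,
          mul_one]
    _ = ∫ s in Set.Ioi (0 : ℝ), ∑ q ∈ Finset.Icc 1 X,
          vonMangoldt q / q * (s * Real.exp (-((Real.log q + L) * s))) :=
        (MeasureTheory.integral_finsetSum _ hint).symm
    _ ≤ ∫ s in Set.Ioi (0 : ℝ), (1 / 2 * Real.exp (-L * s) + 1 / 2 * Real.exp (-(L + 1) * s)) := by
        refine MeasureTheory.setIntegral_mono_on (MeasureTheory.integrable_finsetSum _ hint)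
          ((hexp L hL).add (hexp _ hL1)) measurableSet_Ioi fun s hs => ?_
        have hs : 0 < s := hs
        have hV := sum_vonMangoldt_mul_rpow_le hs X
        have hE : 0 < Real.exp (-L * s) := Real.exp_pos _
        have hterm : ∀ q ∈ Finset.Icc 1 X,
            vonMangoldt q / q * (s * Real.exp (-((Real.log q + L) * s)))
              = s * Real.exp (-L * s) * (vonMangoldt q * (q : ℝ) ^ (-(1 + s))) := by
          intro q hq
          have hq0 : (0 : ℝ) < q := by
            exact_mod_cast (Finset.mem_Icc.1 hq).1
          rw [show -(1 + s) = -1 + -s by ring, Real.rpow_add hq0, Real.rpow_neg_one,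
            rpow_neg_eq_exp hq0, show -((Real.log q + L) * s) = -L * s + -s * Real.log q by ring,
            Real.exp_add]
          ring
        rw [Finset.sum_congr rfl hterm, ← Finset.mul_sum]
        refine (mul_le_mul_of_nonneg_left hV (by positivity)).trans ?_
        have hpade : 1 / (1 + s / 2) ≤ 1 / 2 + 1 / 2 * Real.exp (-s) := by
          rw [div_le_iff₀ (by positivity)]
          linarith [one_sub_half_le_exp_neg_mul hs.le]
        rw [show -(L + 1) * s = -L * s + -s by ring, Real.exp_add]
        have h1 : s * Real.exp (-L * s) * (1 / s * (1 / (1 + s / 2)))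
            = Real.exp (-L * s) * (1 / (1 + s / 2)) := by field_simp
        rw [h1]
        linarith [mul_le_mul_of_nonneg_left hpade hE.le]
    _ = 1 / 2 * (1 / L) + 1 / 2 * (1 / (L + 1)) := by
        rw [MeasureTheory.integral_add (hexp L hL) (hexp _ hL1), hval L hL, hval _ hL1]

noncomputable def erdosWeight (n : ℕ) : ℝ := 1 / (n * Real.log n)

theorem erdosWeight_nonneg (n : ℕ) : 0 ≤ erdosWeight n :=
  one_div_nonneg.2 (mul_nonneg n.cast_nonneg (Real.log_natCast_nonneg n))

open ArithmeticFunction in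
/-- Transition probabilities of a downward divisor chain: from a composite `n` divide by `q ∣ n`
with probability `Λ q / log n`, except that a prime power moves to its prime instead of to `1`. -/
noncomputable def chainStep (n d : ℕ) : ℝ :=
  if d ∣ n then (vonMangoldt (n / d) + if d = n.minFac then vonMangoldt n else 0) / Real.log n
  else 0

open ArithmeticFunction in
theorem chainStep_nonneg (n d : ℕ) : 0 ≤ chainStep n d := by
  unfold chainStep
  split_ifs
  · exact div_nonneg (add_nonneg vonMangoldt_nonneg vonMangoldt_nonneg)
      (Real.log_natCast_nonneg n)
  · exact div_nonneg (add_nonneg vonMangoldt_nonneg le_rfl) (Real.log_natCast_nonneg n)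
  · exact le_rfl

theorem chainStep_eq_zero_of_not_dvd {n d : ℕ} (h : ¬ d ∣ n) : chainStep n d = 0 := if_neg h

theorem sum_chainStep_of_prime {n : ℕ} (hn : n.Prime) :
    ∑ d ∈ Finset.Ico 2 n, chainStep n d = 0 := by
  refine Finset.sum_eq_zero fun d hd => chainStep_eq_zero_of_not_dvd fun hdvd => ?_
  rw [Finset.mem_Ico] at hd
  rcases (Nat.dvd_prime hn).1 hdvd with h | h <;> omega

open ArithmeticFunction in
theorem sum_chainStep_of_not_prime {n : ℕ} (hn2 : 2 ≤ n) (hn : ¬ n.Prime) :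
    ∑ d ∈ Finset.Ico 2 n, chainStep n d = 1 := by
  have hlog : 0 < Real.log n := Real.log_pos (by exact_mod_cast hn2)
  have hdiv : n.divisors = insert n (insert 1 ((Finset.Ico 2 n).filter (· ∣ n))) := by
    ext d
    simp only [Nat.mem_divisors, Finset.mem_insert, Finset.mem_filter, Finset.mem_Ico]
    constructor
    · rintro ⟨h, h0⟩
      have h1 := Nat.le_of_dvd (by omega) h
      have h2 := Nat.pos_of_dvd_of_pos h (by omega)
      by_cases d = n <;> by_cases d = 1 <;> simp_all
      omega
    · rintro (rfl | rfl | h)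
      · exact ⟨dvd_rfl, by omega⟩
      · exact ⟨one_dvd _, by omega⟩
      · exact ⟨h.2, by omega⟩
  have hsum : ∑ d ∈ (Finset.Ico 2 n).filter (· ∣ n), vonMangoldt (n / d)
      = Real.log n - vonMangoldt n := by
    have h := Nat.sum_div_divisors n (fun i => vonMangoldt i)
    rw [vonMangoldt_sum, hdiv, Finset.sum_insert, Finset.sum_insert,
      Nat.div_self (by omega), Nat.div_one, vonMangoldt_apply_one] at h
    · linarith
    · simp
    · simp; omega
  have hmin : n.minFac ∈ (Finset.Ico 2 n).filter (· ∣ n) :=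
    Finset.mem_filter.2 ⟨Finset.mem_Ico.2 ⟨(Nat.minFac_prime (by omega)).two_le,
      (Nat.not_prime_iff_minFac_lt hn2).1 hn⟩, n.minFac_dvd⟩
  unfold chainStep
  rw [← Finset.sum_filter, ← Finset.sum_div, Finset.sum_add_distrib, hsum,
    Finset.sum_ite_eq' , if_pos hmin, sub_add_cancel, div_self hlog.ne']

open ArithmeticFunction in
theorem sum_vonMangoldt_minFac_le {d : ℕ} (hd : 2 ≤ d) (N : ℕ) :
    ∑ n ∈ Finset.Ioc d N, (if d = n.minFac then vonMangoldt n else 0) / (n * Real.log n ^ 2)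
      ≤ 1 / (4 * Real.log d) * (1 / (d * (d - 1))) := by
  have hd2 : (2 : ℝ) ≤ d := by exact_mod_cast hd
  have hL : 0 < Real.log d := Real.log_pos (by linarith)
  by_cases hp : d.Prime
  swap
  · rw [Finset.sum_eq_zero]
    · have : (0 : ℝ) < d - 1 := by linarith
      positivity
    · intro n hn
      rw [Finset.mem_Ioc] at hn
      rw [if_neg, zero_div]
      rintro rfl
      exact hp (Nat.minFac_prime (by omega))
  have hinj : Set.InjOn (fun k => d ^ k) (Finset.Icc 2 N : Set ℕ) := fun _ _ _ _ h =>
    Nat.pow_right_injective hd h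
  have hterm_nonneg : ∀ n : ℕ,
      0 ≤ (if d = n.minFac then vonMangoldt n else 0) / (n * Real.log n ^ 2) := by
    intro n
    refine div_nonneg ?_ (by positivity)
    split_ifs
    exacts [vonMangoldt_nonneg, le_rfl]
  calc ∑ n ∈ Finset.Ioc d N, (if d = n.minFac then vonMangoldt n else 0) / (n * Real.log n ^ 2)
      = ∑ n ∈ (Finset.Ioc d N).filter (fun n => d = n.minFac ∧ IsPrimePow n),
          (if d = n.minFac then vonMangoldt n else 0) / (n * Real.log n ^ 2) := by
        refine (Finset.sum_filter_of_ne fun n _ hne => ?_).symm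
        by_contra hcon
        apply hne
        split_ifs with h
        · rw [vonMangoldt_eq_zero_iff.2 fun hpp => hcon ⟨h, hpp⟩, zero_div]
        · exact zero_div _
    _ ≤ ∑ n ∈ (Finset.Icc 2 N).image (fun k => d ^ k),
          (if d = n.minFac then vonMangoldt n else 0) / (n * Real.log n ^ 2) := by
        refine Finset.sum_le_sum_of_subset_of_nonneg (fun n hn => ?_) fun n _ _ => hterm_nonneg n
        obtain ⟨hn, hmin, hpp⟩ := Finset.mem_filter.1 hn
        rw [Finset.mem_Ioc] at hn
        obtain ⟨p, k, hp', hk, rfl⟩ := (isPrimePow_nat_iff _).1 hpp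
        rw [hp'.pow_minFac hk.ne'] at hmin
        subst hmin
        refine Finset.mem_image.2 ⟨k, Finset.mem_Icc.2 ⟨?_, ?_⟩, rfl⟩
        · by_contra hlt
          obtain rfl : k = 1 := by omega
          simp at hn
        · exact (Nat.lt_pow_self (by omega)).le.trans hn.2
    _ = ∑ k ∈ Finset.Icc 2 N, 1 / Real.log d * (1 / (k : ℝ) ^ 2 * (1 / (d : ℝ)) ^ k) := by
        rw [Finset.sum_image hinj]
        refine Finset.sum_congr rfl fun k hk => ?_
        have hk0 : k ≠ 0 := by have := (Finset.mem_Icc.1 hk).1; omega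
        have hk' : (k : ℝ) ≠ 0 := by exact_mod_cast hk0
        rw [if_pos (hp.pow_minFac hk0).symm, vonMangoldt_apply_pow hk0, vonMangoldt_apply_prime hp]
        push_cast
        rw [Real.log_pow, one_div_pow]
        field_simp
    _ ≤ ∑ k ∈ Finset.Icc 2 N, 1 / Real.log d * (1 / 4 * (1 / (d : ℝ)) ^ k) := by
        refine Finset.sum_le_sum fun k hk => ?_
        have hk2 : (2 : ℝ) ≤ k := by exact_mod_cast (Finset.mem_Icc.1 hk).1
        have : 1 / (k : ℝ) ^ 2 ≤ 1 / 4 := one_div_le_one_div_of_le (by norm_num) (by nlinarith)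
        gcongr
    _ = 1 / (4 * Real.log d) * ∑ k ∈ Finset.Icc 2 N, (1 / (d : ℝ)) ^ k := by
        rw [Finset.mul_sum]
        refine Finset.sum_congr rfl fun k _ => ?_
        field_simp
    _ ≤ 1 / (4 * Real.log d) * (1 / (d * (d - 1))) := by
        refine mul_le_mul_of_nonneg_left ?_ (by positivity)
        have hgeom := geom_sum_Ico_le_of_lt_one (m := 2) (n := N + 1)
          (show (0 : ℝ) ≤ 1 / d by positivity) (by rw [div_lt_one (by positivity)]; linarith)
        have hIcc : Finset.Icc 2 N = Finset.Ico 2 (N + 1) := by ext; simp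
        rw [hIcc]
        refine hgeom.trans (le_of_eq ?_)
        have : (d : ℝ) - 1 ≠ 0 := by linarith
        field_simp

open ArithmeticFunction in
theorem sum_chainStep_mul_erdosWeight_le {d : ℕ} (hd : 2 ≤ d) (N : ℕ) :
    ∑ n ∈ Finset.Ioc d N, chainStep n d * erdosWeight n ≤ erdosWeight d := by
  have hd2 : (2 : ℝ) ≤ d := by exact_mod_cast hd
  have hL : 0 < Real.log d := Real.log_pos (by linarith)
  have hsplit : ∀ n ∈ Finset.Ioc d N, chainStep n d * erdosWeight n
      ≤ (if d ∣ n then vonMangoldt (n / d) / (n * Real.log n ^ 2) else 0)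
        + (if d = n.minFac then vonMangoldt n else 0) / (n * Real.log n ^ 2) := by
    intro n _
    unfold chainStep erdosWeight
    have h0 : 0 ≤ (if d = n.minFac then vonMangoldt n else 0) / (n * Real.log n ^ 2) := by
      refine div_nonneg ?_ (by positivity)
      split_ifs
      exacts [vonMangoldt_nonneg, le_rfl]
    by_cases h : d ∣ n
    · rw [if_pos h, if_pos h, div_mul_div_comm, mul_one, ← add_div]
      refine le_of_eq ?_
      congr 1
      ring
    · rw [if_neg h, if_neg h]
      simpa using h0
  have hfirst : ∑ n ∈ Finset.Ioc d N,
      (if d ∣ n then vonMangoldt (n / d) / (n * Real.log n ^ 2) else 0)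
        ≤ 1 / d * (1 / 2 * (1 / Real.log d) + 1 / 2 * (1 / (Real.log d + 1))) := by
    refine le_trans ?_ (mul_le_mul_of_nonneg_left (sum_vonMangoldt_div_mul_log_sq_le hL N)
      (by positivity))
    rw [← Finset.sum_filter, Finset.mul_sum]
    calc ∑ n ∈ (Finset.Ioc d N).filter (d ∣ ·), vonMangoldt (n / d) / (n * Real.log n ^ 2)
        ≤ ∑ n ∈ (Finset.Icc 1 N).image (d * ·), vonMangoldt (n / d) / (n * Real.log n ^ 2) := by
          refine Finset.sum_le_sum_of_subset_of_nonneg (fun n hn => ?_) fun n _ _ =>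
            div_nonneg vonMangoldt_nonneg (by positivity)
          obtain ⟨hn, q, rfl⟩ := Finset.mem_filter.1 hn
          rw [Finset.mem_Ioc] at hn
          refine Finset.mem_image.2 ⟨q, Finset.mem_Icc.2 ⟨?_, ?_⟩, rfl⟩
          · by_contra h
            obtain rfl : q = 0 := by omega
            omega
          · exact (Nat.le_mul_of_pos_left q (by omega)).trans hn.2
      _ = ∑ q ∈ Finset.Icc 1 N, 1 / d * (vonMangoldt q / (q * (Real.log q + Real.log d) ^ 2)) := by
          rw [Finset.sum_image fun _ _ _ _ h => Nat.eq_of_mul_eq_mul_left (by omega : 0 < d) h]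
          refine Finset.sum_congr rfl fun q hq => ?_
          have hq0 : (q : ℝ) ≠ 0 := by
            have := (Finset.mem_Icc.1 hq).1
            positivity
          rw [Nat.mul_div_cancel_left q (by omega), Nat.cast_mul,
            Real.log_mul (by positivity) hq0, div_mul_div_comm, one_mul]
          congr 1
          ring
  refine (Finset.sum_le_sum hsplit).trans ?_
  rw [Finset.sum_add_distrib]
  refine (add_le_add hfirst (sum_vonMangoldt_minFac_le hd N)).trans ?_
  have hlog : Real.log d + 1 ≤ 2 * (d - 1) := by
    linarith [Real.log_le_sub_one_of_pos (show (0 : ℝ) < d by linarith)]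
  have h1 : 1 / (2 * ((d : ℝ) - 1)) ≤ 1 / (Real.log d + 1) :=
    one_div_le_one_div_of_le (by linarith) hlog
  have hd1 : (0 : ℝ) < d - 1 := by linarith
  have hL1 : (0 : ℝ) < Real.log d + 1 := by linarith
  have h2 : 1 / Real.log d * (1 / (2 * ((d : ℝ) - 1))) ≤ 1 / Real.log d * (1 / (Real.log d + 1)) :=
    mul_le_mul_of_nonneg_left h1 (by positivity)
  have h3 : 1 / Real.log d * (1 / (Real.log d + 1)) = 1 / Real.log d - 1 / (Real.log d + 1) := by
    field_simp; ring
  have h4 : 1 / (4 * Real.log d) * (1 / (d * ((d : ℝ) - 1)))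
      = 1 / d * (1 / 2 * (1 / Real.log d * (1 / (2 * ((d : ℝ) - 1))))) := by
    field_simp; norm_num
  have h5 : erdosWeight d = 1 / d * (1 / Real.log d) := by
    unfold erdosWeight; rw [div_mul_div_comm, one_mul]
  rw [h4, h5, ← mul_add]
  refine mul_le_mul_of_nonneg_left ?_ (by positivity)
  linarith

/-- Total mass carried by the divisor chain through `d` when every `a ∈ A` emits mass
`erdosWeight a`; only integers up to `N` are taken into account. -/
noncomputable def chainFlow (A : Finset ℕ) (N d : ℕ) : ℝ :=
  (if d ∈ A then erdosWeight d else 0)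
    + ∑ n ∈ (Finset.Ioc d N).attach, chainStep n d * chainFlow A N n
termination_by N - d
decreasing_by
  have := Finset.mem_Ioc.1 n.2
  omega

theorem chainFlow_eq (A : Finset ℕ) (N d : ℕ) :
    chainFlow A N d = (if d ∈ A then erdosWeight d else 0)
      + ∑ n ∈ Finset.Ioc d N, chainStep n d * chainFlow A N n := by
  rw [chainFlow, Finset.sum_attach (Finset.Ioc d N) fun n => chainStep n d * chainFlow A N n]

theorem chainFlow_eq_zero {A : Finset ℕ} {N d : ℕ} (h : ∀ a ∈ A, ¬ d ∣ a) :
    chainFlow A N d = 0 := by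
  induction hk : N - d using Nat.strong_induction_on generalizing d with
  | _ k ih =>
    rw [chainFlow_eq, if_neg fun hd => h d hd dvd_rfl, zero_add]
    refine Finset.sum_eq_zero fun n hn => ?_
    rw [Finset.mem_Ioc] at hn
    by_cases hdn : d ∣ n
    · rw [ih (N - n) (by omega) (fun a ha hna => h a ha (hdn.trans hna)) rfl, mul_zero]
    · rw [chainStep_eq_zero_of_not_dvd hdn, zero_mul]

theorem chainFlow_le {A : Finset ℕ} (hA : IsPrimitive (A : Set ℕ)) {N d : ℕ} (hd : 2 ≤ d) :
    chainFlow A N d ≤ erdosWeight d := by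
  induction hk : N - d using Nat.strong_induction_on generalizing d with
  | _ k ih =>
    rw [chainFlow_eq]
    by_cases hdA : d ∈ A
    · rw [if_pos hdA, Finset.sum_eq_zero, add_zero]
      intro n hn
      rw [Finset.mem_Ioc] at hn
      by_cases hdn : d ∣ n
      · rw [chainFlow_eq_zero, mul_zero]
        intro a ha hna
        refine hA.2 d hdA a ha ?_ (hdn.trans hna)
        rintro rfl
        exact absurd (Nat.le_of_dvd (by omega) hna) (by omega)
      · rw [chainStep_eq_zero_of_not_dvd hdn, zero_mul]
    · rw [if_neg hdA, zero_add]
      refine le_trans (Finset.sum_le_sum fun n hn => ?_) (sum_chainStep_mul_erdosWeight_le hd N)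
      rw [Finset.mem_Ioc] at hn
      exact mul_le_mul_of_nonneg_left (ih (N - n) (by omega) (by omega) rfl)
        (chainStep_nonneg n d)

theorem sum_chainFlow_primes {A : Finset ℕ} {N : ℕ} (hA : A ⊆ Finset.Icc 2 N) :
    ∑ p ∈ (Finset.Icc 2 N).filter Nat.Prime, chainFlow A N p = ∑ a ∈ A, erdosWeight a := by
  have hsum : ∑ d ∈ Finset.Icc 2 N, chainFlow A N d = ∑ a ∈ A, erdosWeight a
      + ∑ n ∈ Finset.Icc 2 N, (∑ d ∈ Finset.Ico 2 n, chainStep n d) * chainFlow A N n := by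
    rw [Finset.sum_congr rfl fun d _ => chainFlow_eq A N d, Finset.sum_add_distrib,
      Finset.sum_ite_mem, Finset.inter_eq_right.2 hA]
    congr 1
    rw [Finset.sum_congr rfl fun n _ => Finset.sum_mul _ _ _]
    refine Finset.sum_comm' fun d n => ?_
    simp only [Finset.mem_Icc, Finset.mem_Ioc, Finset.mem_Ico]
    omega
  have hstep : ∑ n ∈ Finset.Icc 2 N, (∑ d ∈ Finset.Ico 2 n, chainStep n d) * chainFlow A N n
      = ∑ n ∈ (Finset.Icc 2 N).filter (¬ Nat.Prime ·), chainFlow A N n := by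
    rw [Finset.sum_filter]
    refine Finset.sum_congr rfl fun n hn => ?_
    by_cases hp : n.Prime
    · rw [sum_chainStep_of_prime hp, zero_mul, if_neg (not_not.2 hp)]
    · rw [sum_chainStep_of_not_prime (Finset.mem_Icc.1 hn).1 hp, one_mul, if_pos hp]
  have hfil := Finset.sum_filter_add_sum_filter_not (Finset.Icc 2 N) Nat.Prime (chainFlow A N)
  linarith

theorem sum_erdosWeight_le_sum_primes {A : Finset ℕ} (hA : IsPrimitive (A : Set ℕ)) {N : ℕ}
    (hN : A ⊆ Finset.Icc 2 N) :
    ∑ a ∈ A, erdosWeight a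
      ≤ ∑ p ∈ (Finset.Icc 2 N).filter (fun p => p.Prime ∧ ∃ a ∈ A, p ∣ a), erdosWeight p := by
  rw [← sum_chainFlow_primes hN, ← Finset.filter_filter,
    Finset.sum_filter (fun p => ∃ a ∈ A, p ∣ a)]
  refine Finset.sum_le_sum fun p hp => ?_
  split_ifs with h
  · exact chainFlow_le hA (Finset.mem_Icc.1 (Finset.mem_filter.1 hp).1).1
  · rw [chainFlow_eq_zero fun a ha hpa => h ⟨a, ha, hpa⟩]

open ArithmeticFunction in
theorem summable_erdosWeight_of_prime {S : Set ℕ} (hS : ∀ p ∈ S, p.Prime) :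
    Summable fun p : S => erdosWeight p := by
  have hL : 0 < Real.log 2 := Real.log_pos one_lt_two
  refine summable_of_sum_le (c := 4 * (1 / 2 * (1 / Real.log 2) + 1 / 2 * (1 / (Real.log 2 + 1))))
    (fun p => erdosWeight_nonneg p) fun u => ?_
  set v : Finset ℕ := u.map (Function.Embedding.subtype _) with hv
  have huv : ∑ p ∈ u, erdosWeight p = ∑ p ∈ v, erdosWeight p := by
    rw [hv, Finset.sum_map]; rfl
  have hprime : ∀ p ∈ v, p.Prime := by
    intro p hp
    obtain ⟨x, -, rfl⟩ := Finset.mem_map.1 hp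
    exact hS x x.2
  rw [huv]
  refine le_trans ?_ (mul_le_mul_of_nonneg_left
    (sum_vonMangoldt_div_mul_log_sq_le hL (v.sup id)) (by norm_num))
  rw [Finset.mul_sum]
  refine le_trans (Finset.sum_le_sum fun p hp => ?_) (Finset.sum_le_sum_of_subset_of_nonneg
    (fun p hp => Finset.mem_Icc.2 ⟨(hprime p hp).one_le, Finset.le_sup (f := id) hp⟩)
    fun q _ _ => mul_nonneg (by norm_num) (div_nonneg vonMangoldt_nonneg (by positivity)))
  have hp := hprime p hp
  have hp2 : (2 : ℝ) ≤ p := by exact_mod_cast hp.two_le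
  have hlog : Real.log 2 ≤ Real.log p := Real.log_le_log two_pos hp2
  have hlp : 0 < Real.log p := hL.trans_le hlog
  rw [vonMangoldt_apply_prime hp, erdosWeight, mul_div_assoc', div_le_div_iff₀ (by positivity)
    (by positivity)]
  have : (Real.log p + Real.log 2) ^ 2 ≤ 4 * Real.log p ^ 2 := by nlinarith
  nlinarith [mul_le_mul_of_nonneg_left this (show (0 : ℝ) ≤ p by positivity)]

/-- Among primitive sets with a given prime support, the set of primes maximizes `f`. -/
theorem f_le_tsum_primeSupport {A : Set ℕ} (hA : IsPrimitive A) :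
    f A ≤ ∑' p : primeSupport A, 1 / ((p : ℕ) * Real.log (p : ℕ)) := by
  have hsummable : Summable fun p : primeSupport A => erdosWeight p :=
    summable_erdosWeight_of_prime fun p hp => hp.1
  refine Real.tsum_le_of_sum_le (fun a => erdosWeight_nonneg a) fun u => ?_
  set v : Finset ℕ := u.map (Function.Embedding.subtype _) with hv
  have huv : ∑ a ∈ u, erdosWeight a = ∑ a ∈ v, erdosWeight a := by
    rw [hv, Finset.sum_map]; rfl
  have hvA : ∀ a ∈ v, a ∈ A := by
    intro a ha
    obtain ⟨x, -, rfl⟩ := Finset.mem_map.1 ha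
    exact x.2
  have hprim : IsPrimitive (v : Set ℕ) :=
    ⟨fun a ha => hA.1 a (hvA a ha), fun a ha b hb => hA.2 a (hvA a ha) b (hvA b hb)⟩
  have hN : v ⊆ Finset.Icc 2 (v.sup id) := fun a ha =>
    Finset.mem_Icc.2 ⟨hA.1 a (hvA a ha), Finset.le_sup (f := id) ha⟩
  change ∑ a ∈ u, erdosWeight a ≤ ∑' p : primeSupport A, erdosWeight p
  rw [huv]
  refine (sum_erdosWeight_le_sum_primes hprim hN).trans ?_
  have hmem : ∀ p ∈ (Finset.Icc 2 (v.sup id)).filter (fun p => p.Prime ∧ ∃ a ∈ v, p ∣ a),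
      p ∈ primeSupport A := by
    intro p hp
    obtain ⟨-, hp, a, ha, hpa⟩ := Finset.mem_filter.1 hp
    exact ⟨hp, a, hvA a ha, hpa⟩
  classical
  rw [← Finset.sum_subtype_of_mem erdosWeight hmem]
  exact hsummable.sum_le_tsum _ fun p _ => erdosWeight_nonneg p

theorem eps0_nonneg : 0 ≤ eps0 := by
  refine tsum_nonneg fun p => ?_
  have h := not_le.1 p.2.2.2
  have := mul_le_mul_of_nonneg_left h.le (show (0 : ℝ) ≤ 1 / (p : ℕ) by positivity)
  rw [div_mul_div_comm, one_mul] at this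
  unfold g
  linarith

theorem curious_parity (A : Set ℕ) (hA : IsPrimitive A)
    (h : f A > (∑' p : primeSupport A, 1 / ((p : ℕ) * Real.log (p : ℕ))) + eps0) :
    f {a ∈ A | Odd a} <
      ∑' p : primeSupport {a ∈ A | Odd a}, 1 / ((p : ℕ) * Real.log (p : ℕ)) := by
  linarith [f_le_tsum_primeSupport hA, eps0_nonneg]
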